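/- Let G be a finite multigraph on vertex set V with |V| = n, where each edge is coloured with a colour from a set W of cardinality n−1. Then G contains a rainbow spanning tree (a spanning tree in which all edges have distinct colours) if and only if for every subset I ⊆ W, the number of connected components of the spanning subgraph G_I of G consisting of all edges coloured with a colour in I satisfies κ(G_I) ≤ n − |I|. -/

import Mathlib

namespace SimpleGraph

variable {V : Type*}

/-- The functions on the vertices of `G` that are constant along every edge. -/
def edgeConst (G : SimpleGraph V) : Submodule ℚ (V → ℚ) where
  carrier := {f | ∀ u v, G.Adj u v → f u = f v}
  add_mem' hf hg u v h := by simp [hf u v h, hg u v h]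
  zero_mem' _ _ _ := rfl
  smul_mem' a f hf u v h := by simp [hf u v h]

theorem mem_edgeConst {G : SimpleGraph V} {f : V → ℚ} :
    f ∈ G.edgeConst ↔ ∀ u v, G.Adj u v → f u = f v := Iff.rfl

theorem eq_of_reachable_of_mem_edgeConst {G : SimpleGraph V} {f : V → ℚ} (hf : f ∈ G.edgeConst)
    {u v : V} (h : G.Reachable u v) : f u = f v := by
  obtain ⟨p⟩ := h
  induction p with
  | nil => rfl
  | cons h _ ih => exact (hf _ _ h).trans ih

theorem edgeConst_anti {G H : SimpleGraph V} (h : G ≤ H) : H.edgeConst ≤ G.edgeConst :=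
  fun _ hf u v huv => hf u v (h huv)

theorem edgeConst_sup (G H : SimpleGraph V) :
    (G ⊔ H).edgeConst = G.edgeConst ⊓ H.edgeConst := by
  ext f
  simp only [Submodule.mem_inf, mem_edgeConst, sup_adj]
  grind

theorem range_funLeft_connectedComponentMk (G : SimpleGraph V) :
    LinearMap.range (LinearMap.funLeft ℚ ℚ G.connectedComponentMk) = G.edgeConst := by
  ext f
  constructor
  · rintro ⟨g, rfl⟩ u v h
    simp [LinearMap.funLeft_apply, ConnectedComponent.eq.2 h.reachable]
  · intro hf
    refine ⟨fun C => C.lift f fun u v p _ => eq_of_reachable_of_mem_edgeConst hf p.reachable, ?_⟩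
    ext v
    rfl

variable [Fintype V]

theorem card_connectedComponent_eq_finrank_edgeConst (G : SimpleGraph V) :
    Nat.card G.ConnectedComponent = Module.finrank ℚ G.edgeConst := by
  classical
  have := Fintype.ofFinite G.ConnectedComponent
  rw [← range_funLeft_connectedComponentMk, LinearMap.finrank_range_of_inj
    (LinearMap.funLeft_injective_of_surjective ℚ ℚ G.connectedComponentMk Quot.mk_surjective),
    Module.finrank_fintype_fun_eq_card, Nat.card_eq_fintype_card]

theorem card_connectedComponent_anti {G H : SimpleGraph V} (h : G ≤ H) :
    Nat.card H.ConnectedComponent ≤ Nat.card G.ConnectedComponent := by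
  simp only [card_connectedComponent_eq_finrank_edgeConst]
  exact Submodule.finrank_mono (edgeConst_anti h)

/-- The number of connected components is supermodular. -/
theorem card_connectedComponent_add_le (G H : SimpleGraph V) :
    Nat.card G.ConnectedComponent + Nat.card H.ConnectedComponent ≤
      Nat.card (G ⊔ H).ConnectedComponent + Nat.card (G ⊓ H).ConnectedComponent := by
  simp only [card_connectedComponent_eq_finrank_edgeConst]
  rw [← Submodule.finrank_sup_add_finrank_inf_eq, edgeConst_sup, add_comm]
  exact Nat.add_le_add_left (Submodule.finrank_mono
    (sup_le (edgeConst_anti (inf_le_left : G ⊓ H ≤ G)) (edgeConst_anti inf_le_right))) _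

theorem card_connectedComponent_le_card (G : SimpleGraph V) :
    Nat.card G.ConnectedComponent ≤ Fintype.card V := by
  rw [← Nat.card_eq_fintype_card]
  exact Nat.card_le_card_of_surjective G.connectedComponentMk Quot.mk_surjective

theorem card_connectedComponent_bot :
    Nat.card (⊥ : SimpleGraph V).ConnectedComponent = Fintype.card V := by
  have : (⊥ : SimpleGraph V).edgeConst = ⊤ := by
    ext f
    simp [mem_edgeConst]
  rw [card_connectedComponent_eq_finrank_edgeConst, this, finrank_top,
    Module.finrank_fintype_fun_eq_card]

theorem card_le_card_connectedComponent_fromEdgeSet_singleton_add_one (e : Sym2 V) :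
    Fintype.card V ≤ Nat.card (fromEdgeSet {e}).ConnectedComponent + 1 := by
  induction e with | _ u v
  let φ : (V → ℚ) →ₗ[ℚ] ℚ :=
    LinearMap.proj (R := ℚ) (φ := fun _ : V => ℚ) u -
      LinearMap.proj (R := ℚ) (φ := fun _ : V => ℚ) v
  have hker : LinearMap.ker φ ≤ (fromEdgeSet {s(u, v)}).edgeConst := by
    intro f hf a b hab
    have : f u - f v = 0 := hf
    simp only [fromEdgeSet_adj, Set.mem_singleton_iff, Sym2.eq_iff] at hab
    grind
  have hrank := φ.finrank_range_add_finrank_ker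
  have hrange : Module.finrank ℚ (LinearMap.range φ) ≤ 1 := by
    simpa using Submodule.finrank_le (LinearMap.range φ)
  have := Submodule.finrank_mono hker
  rw [Module.finrank_fintype_fun_eq_card] at hrank
  rw [card_connectedComponent_eq_finrank_edgeConst]
  omega

theorem card_connectedComponent_fromEdgeSet_le_insert (s : Set (Sym2 V)) (e : Sym2 V) :
    Nat.card (fromEdgeSet s).ConnectedComponent ≤
      Nat.card (fromEdgeSet (insert e s)).ConnectedComponent + 1 := by
  have h := card_connectedComponent_add_le (fromEdgeSet {e}) (fromEdgeSet s)
  rw [← fromEdgeSet_union, Set.singleton_union] at h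
  have := card_connectedComponent_le_card (fromEdgeSet {e} ⊓ fromEdgeSet s)
  have := card_le_card_connectedComponent_fromEdgeSet_singleton_add_one e
  omega

theorem card_connectedComponent_fromEdgeSet_le_union {E : Type*} (ends : E → Sym2 V)
    (s : Set E) (t : Finset E) :
    Nat.card (fromEdgeSet (ends '' s)).ConnectedComponent ≤
      Nat.card (fromEdgeSet (ends '' (s ∪ t))).ConnectedComponent + t.card := by
  classical
  induction t using Finset.induction_on with
  | empty => simp
  | insert e t he ih =>
    rw [Finset.coe_insert, Set.union_insert, Set.image_insert_eq, Finset.card_insert_of_notMem he]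
    have := card_connectedComponent_fromEdgeSet_le_insert (ends '' (s ∪ t)) (ends e)
    omega

end SimpleGraph

/-- A form of Rado's theorem: if `f` is monotone and submodular and every union of colour classes
indexed by `I` has `f`-value at least `|I|`, then some set meeting each colour class at most once
has the same property. -/
theorem Finset.exists_injOn_card_le_of_submodular {E W : Type*} [Fintype E] [DecidableEq E]
    [DecidableEq W] (c : E → W) (f : Finset E → ℤ) (hmono : Monotone f)
    (hsub : ∀ X Y, f (X ∪ Y) + f (X ∩ Y) ≤ f X + f Y)
    (hf : ∀ I : Finset W, (I.card : ℤ) ≤ f {e | c e ∈ I}) :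
    ∃ A : Finset E, Set.InjOn c A ∧ ∀ I : Finset W, (I.card : ℤ) ≤ f {e ∈ A | c e ∈ I} := by
  obtain ⟨A, hA⟩ := exists_minimal_of_wellFoundedLT
    (fun A : Finset E => ∀ I : Finset W, (I.card : ℤ) ≤ f {e ∈ A | c e ∈ I}) ⟨univ, hf⟩
  refine ⟨A, fun x hx y hy hxy => ?_, hA.prop⟩
  by_contra hne
  have key : ∀ z ∈ A, ∃ I : Finset W, c z ∈ I ∧ f {e ∈ A.erase z | c e ∈ I} < I.card := by
    intro z hz
    have := hA.not_prop_of_lt (erase_ssubset hz)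
    push Not at this
    obtain ⟨I, hI⟩ := this
    refine ⟨I, ?_, hI⟩
    by_contra hzI
    have heq : ({e ∈ A.erase z | c e ∈ I} : Finset E) = {e ∈ A | c e ∈ I} := by grind
    exact absurd (hA.prop I) (by rw [← heq]; exact not_le.2 hI)
  obtain ⟨I, hxI, hI⟩ := key x hx
  obtain ⟨J, hyJ, hJ⟩ := key y hy
  have hunion := (hA.prop (I ∪ J)).trans <| hmono
    (show ({e ∈ A | c e ∈ I ∪ J} : Finset E) ≤
      {e ∈ A.erase x | c e ∈ I} ∪ {e ∈ A.erase y | c e ∈ J} by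
        intro e; grind)
  have hinter := (hA.prop ((I ∩ J).erase (c x))).trans <| hmono
    (show ({e ∈ A | c e ∈ (I ∩ J).erase (c x)} : Finset E) ≤
      {e ∈ A.erase x | c e ∈ I} ∩ {e ∈ A.erase y | c e ∈ J} by
        intro e; grind)
  have := hsub {e ∈ A.erase x | c e ∈ I} {e ∈ A.erase y | c e ∈ J}
  have := card_union_add_card_inter I J
  have := card_erase_add_one (show c x ∈ I ∩ J by grind)
  omega

open SimpleGraph in
/-- A coloured multigraph on `n` vertices (edge set `E`, endpoints `ends`,
colouring `c` into a colour set `W` of size `n-1`) has a rainbow spanning tree iff for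
every set `I` of colours, the subgraph `G_I` of edges coloured in `I` has at most
`n - |I|` connected components. -/
theorem rainbow_spanning_tree_iff
    {V W E : Type*} [Fintype V] [Fintype W] [Fintype E] [DecidableEq W]
    (n : ℕ) (hn : 1 ≤ n) (hV : Fintype.card V = n) (hW : Fintype.card W = n - 1)
    (ends : E → Sym2 V) (c : E → W) :
    (∃ T : Finset E, T.card = n - 1 ∧ Set.InjOn c (T : Set E) ∧
        (SimpleGraph.fromEdgeSet (ends '' (T : Set E))).Connected) ↔
      (∀ I : Finset W,
        Nat.card (SimpleGraph.fromEdgeSet (ends '' {e | c e ∈ I})).ConnectedComponent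
          ≤ n - I.card) := by
  classical
  constructor
  · rintro ⟨T, hT, hinj, hconn⟩ I
    have hone : Nat.card (fromEdgeSet (ends '' (T : Set E))).ConnectedComponent = 1 :=
      Nat.card_eq_one_iff_unique.2
        ⟨hconn.preconnected.subsingleton_connectedComponent,
          hconn.nonempty.map (connectedComponentMk _)⟩
    have himage : ({e ∈ T | c e ∉ I} : Finset E).image c ⊆ Iᶜ := by
      intro w
      simp only [Finset.mem_image, Finset.mem_filter, Finset.mem_compl]
      grind
    have hcard := Finset.card_le_card himage
    rw [Finset.card_image_of_injOn (hinj.mono (Finset.coe_subset.2 (Finset.filter_subset _ _))),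
      Finset.card_compl, hW] at hcard
    have hle := card_connectedComponent_fromEdgeSet_le_union ends {e | c e ∈ I} {e ∈ T | c e ∉ I}
    have hsub : (T : Set E) ⊆ {e | c e ∈ I} ∪ ({e ∈ T | c e ∉ I} : Finset E) := by
      intro e he
      by_cases h : c e ∈ I <;> simp_all
    have := card_connectedComponent_anti (fromEdgeSet_mono (Set.image_mono (f := ends) hsub))
    have := Finset.card_le_univ I
    omega
  · intro h
    obtain ⟨A, hinj, hA⟩ := Finset.exists_injOn_card_le_of_submodular c
      (fun X => (n : ℤ) - Nat.card (fromEdgeSet (ends '' (X : Set E))).ConnectedComponent)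
      (fun X Y hXY => by
        have := card_connectedComponent_anti
          (fromEdgeSet_mono (Set.image_mono (f := ends) (Finset.coe_subset.2 hXY)))
        dsimp only
        omega)
      (fun X Y => by
        have hsup := card_connectedComponent_add_le (fromEdgeSet (ends '' (X : Set E)))
          (fromEdgeSet (ends '' (Y : Set E)))
        rw [← fromEdgeSet_union, ← Set.image_union, ← Finset.coe_union, ← fromEdgeSet_inter] at hsup
        have := card_connectedComponent_anti
          (fromEdgeSet_mono (Set.image_inter_subset ends (X : Set E) Y))
        rw [← Finset.coe_inter] at this
        omega)
      (fun I => by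
        have := h I
        have := Finset.card_le_univ I
        simp only [Finset.coe_filter, Finset.mem_univ, true_and]
        omega)
    have huniv := hA Finset.univ
    simp only [Finset.mem_univ, Finset.filter_true, Finset.card_univ] at huniv
    have : Nonempty V := Fintype.card_pos_iff.1 (by omega)
    refine ⟨A, le_antisymm ?_ ?_, hinj, ?_⟩
    · rw [← hW, ← Finset.card_univ]
      exact Finset.card_le_card_of_injOn c (by simp) hinj
    · have := card_connectedComponent_fromEdgeSet_le_union ends ∅ A
      rw [Set.image_empty, fromEdgeSet_empty, card_connectedComponent_bot, Set.empty_union] at this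
      omega
    · have : Subsingleton (fromEdgeSet (ends '' (A : Set E))).ConnectedComponent :=
        (Finite.card_le_one_iff_subsingleton).1 (by omega)
      exact ⟨fun u v => ConnectedComponent.exact (Subsingleton.elim _ _)⟩
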